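/- Let (E,ℳ,μ) be a σ-finite measure space equipped with countable partitions 𝒜_k ⊂ ℳ (k ∈ ℤ) into sets of finite positive measure, where 𝒜_{k+1} refines 𝒜_k. For each A ∈ 𝒜_k let f_A be a μ-measurable function supported on A and constant on every A′ ∈ 𝒜_{k+1} with A′ ⊆ A, with only finitely many f_A not identically zero. Let 𝒩_A be the σ-algebra on A generated by {A′ ∈ 𝒜_{k+1} : A′ ⊆ A} and ν_A := μ(A)^{−1} μ|_{𝒩_A}; let (F,𝒩,ν) be the product F := ∏_{k∈ℤ} ∏_{A∈𝒜_k} A with the product σ-algebra and product probability measure of the ν_A, with generic point y = (y_A). Let (ε_k)_{k∈ℤ} be independent uniform random signs with expectation E_ε. Then for every p ∈ (1,∞), with implied constants depending only on p: ∫_E E_ε |Σ_{k∈ℤ} ε_k Σ_{A∈𝒜_k} f_A(x)|^p dμ(x) ≍ ∫∫_{E×F} E_ε |Σ_{k∈ℤ} ε_k Σ_{A∈𝒜_k} f_A(y_A) 1_A(x)|^p dμ(x) dν(y). -/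

import Mathlib

open MeasureTheory

noncomputable section

open Classical in
/-- Classical indicator of a proposition. -/
def indR (P : Prop) : ℝ := if P then 1 else 0

/-- The real sign associated to a boolean. -/
def sgnB (b : Bool) : ℝ := if b then 1 else -1

/-- The `ℓ∞` norm of an integer vector, as a real number. -/
def inorm {n : ℕ} (m : Fin n → ℤ) : ℝ := ‖(fun i => (m i : ℝ) : Fin n → ℝ)‖

/-- The dyadic cube `2^{-k}([0,1)^n + m)` of generation `k` in `ℝ^n` (with the `ℓ∞` metric). -/
def dyadicCube (n : ℕ) (k : ℤ) (m : Fin n → ℤ) : Set (Fin n → ℝ) :=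
  {x | ∀ i, (2:ℝ) ^ (-k) * m i ≤ x i ∧ x i < (2:ℝ) ^ (-k) * (m i + 1)}

/-- The side length `2^{-k}` of a dyadic cube of generation `k`. -/
def sideLen (k : ℤ) : ℝ := (2:ℝ) ^ (-k)

/-- One-dimensional Haar function on the dyadic interval `2^{-k}[m, m+1)`:
the non-cancellative `h⁰` for `η = false`, the cancellative `h¹` for `η = true`. -/
def haar1D (k : ℤ) (m : ℤ) (η : Bool) (t : ℝ) : ℝ :=
  (Real.sqrt ((2:ℝ) ^ (-k)))⁻¹ *
    (if η then
        (Set.Ico ((2:ℝ) ^ (-k) * m) ((2:ℝ) ^ (-k) * (m + 1/2))).indicator 1 t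
          - (Set.Ico ((2:ℝ) ^ (-k) * (m + 1/2)) ((2:ℝ) ^ (-k) * (m + 1))).indicator 1 t
      else (Set.Ico ((2:ℝ) ^ (-k) * m) ((2:ℝ) ^ (-k) * (m + 1))).indicator 1 t)

/-- The Haar function `h^η_I` for the dyadic cube `I` indexed by `(k, m)`. -/
def haarFn (n : ℕ) (k : ℤ) (m : Fin n → ℤ) (η : Fin n → Bool) (x : Fin n → ℝ) : ℝ :=
  ∏ i, haar1D k (m i) (η i) (x i)

/-- The non-cancellative Haar function `h⁰_I = |I|^{-1/2} 1_I`. -/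
def haarZero (n : ℕ) (k : ℤ) (m : Fin n → ℤ) : (Fin n → ℝ) → ℝ :=
  haarFn n k m (fun _ => false)

/-- The pairing `⟨g, f⟩ = ∫ g f dx`. -/
def pairing {n : ℕ} (g f : (Fin n → ℝ) → ℝ) : ℝ := ∫ x, g x * f x

/-- A normalised standard kernel with Hölder exponent `γ` (with respect to the `ℓ∞` metric). -/
structure IsNormalisedKernel (n : ℕ) (γ : ℝ) (K : (Fin n → ℝ) → (Fin n → ℝ) → ℝ) : Prop where
  size : ∀ x y, x ≠ y → |K x y| ≤ dist x y ^ (-(n:ℝ))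
  smooth : ∀ x y h, 2 * ‖h‖ < dist x y →
    |K (x + h) y - K x y| + |K x (y + h) - K x y| ≤ ‖h‖ ^ γ * dist x y ^ (-(n:ℝ) - γ)

/-- The singular integral `Tf(x) = ∫ K(x,y) f(y) dy`. -/
def czIntegral {n : ℕ} (K : (Fin n → ℝ) → (Fin n → ℝ) → ℝ) (f : (Fin n → ℝ) → ℝ)
    (x : Fin n → ℝ) : ℝ := ∫ y, K x y * f y

/-- The truncated singular integral `T_ε f(x) = ∫_{|y-x|>ε} K(x,y) f(y) dy`. -/
def czTrunc {n : ℕ} (K : (Fin n → ℝ) → (Fin n → ℝ) → ℝ) (ε : ℝ) (f : (Fin n → ℝ) → ℝ)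
    (x : Fin n → ℝ) : ℝ := ∫ y in {y | ε < dist x y}, K x y * f y

/-- The dyadic conditional expectation `E_k f`. -/
def dyadicE (n : ℕ) (k : ℤ) (f : (Fin n → ℝ) → ℝ) (x : Fin n → ℝ) : ℝ :=
  (2:ℝ) ^ (k * (n:ℤ)) * ∫ y in dyadicCube n k (fun i => ⌊(2:ℝ) ^ k * x i⌋), f y

/-- The dyadic martingale difference `D_k f = E_{k+1} f - E_k f`. -/
def dyadicD (n : ℕ) (k : ℤ) (f : (Fin n → ℝ) → ℝ) (x : Fin n → ℝ) : ℝ :=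
  dyadicE n (k+1) f x - dyadicE n k f x

/-- The centre of the dyadic cube indexed by `(k, m)`. -/
def cubeCenter (n : ℕ) (k : ℤ) (m : Fin n → ℤ) : Fin n → ℝ :=
  fun i => (2:ℝ) ^ (-k) * (m i + 1/2)

/-- The concentric `c`-fold expansion of the dyadic cube indexed by `(k, m)`. -/
def expandCube (n : ℕ) (k : ℤ) (m : Fin n → ℤ) (c : ℝ) : Set (Fin n → ℝ) :=
  {x | ∀ i, |x i - cubeCenter n k m i| ≤ c * (2:ℝ) ^ (-k) / 2}

/-- The set `Σ_{f,s} = ⋃_k 9Ω_k`, where `Ω_k` is the union of the cubes `I ∈ 𝒟_k` on which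
`D_{k+s} f` is not a.e. zero. -/
def SigmaSet (n : ℕ) (f : (Fin n → ℝ) → ℝ) (s : ℕ) : Set (Fin n → ℝ) :=
  ⋃ (k : ℤ) (m : Fin n → ℤ)
    (_ : ¬ (∀ᵐ x ∂(volume.restrict (dyadicCube n k m)), dyadicD n (k + (s:ℤ)) f x = 0)),
      expandCube n k m 9

/-- The (measure-theoretic) support of a measurable function: the complement of the union of
all balls on which the function vanishes a.e. -/
def suppAE {n : ℕ} (f : (Fin n → ℝ) → ℝ) : Set (Fin n → ℝ) :=
  {x | ∀ r > 0, ¬ (∀ᵐ y ∂(volume.restrict (Metric.ball x r)), f y = 0)}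

/-- The axis-parallel closed cube with centre `c` and side length `ρ`. -/
def cube (n : ℕ) (c : Fin n → ℝ) (ρ : ℝ) : Set (Fin n → ℝ) :=
  {x | ∀ i, |x i - c i| ≤ ρ / 2}

/-- The index of the `s`-th dyadic ancestor `I^{(s)}` of the cube indexed by `(k, m)`
(the ancestor is the cube indexed by `(k - s, ancestorIdx s m)`). -/
def ancestorIdx {n : ℕ} (s : ℕ) (m : Fin n → ℤ) : Fin n → ℤ :=
  fun i => Int.fdiv (m i) (2 ^ s)

/-- The distance between two sets (in the ambient metric). -/
def setDist {α : Type*} [PseudoMetricSpace α] (A B : Set α) : ℝ :=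
  sInf (Set.image2 dist A B)

open scoped NNReal ENNReal

lemma add_rpow_add_rpow_le_of_le_one {q : ℝ} (hq : 0 ≤ q) (hq1 : q ≤ 1) (b d s : ℝ≥0) :
    (b + d + s) ^ q + b ^ q ≤ (b + s) ^ q + (b + d) ^ q := by
  rcases eq_or_ne (d + s) 0 with h | h
  · obtain ⟨rfl, rfl⟩ := add_eq_zero.1 h
    simp
  have hds : (0 : ℝ) < d + s := by exact_mod_cast pos_iff_ne_zero.2 h
  have hc := (Real.concaveOn_rpow hq hq1).2
  have hb : (b : ℝ) ∈ Set.Ici (0 : ℝ) := b.2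
  have he : (b + d + s : ℝ) ∈ Set.Ici (0 : ℝ) := by
    simp only [Set.mem_Ici]; positivity
  have h1 := hc hb he (a := d / (d + s)) (b := s / (d + s)) (by positivity) (by positivity)
    (by field_simp)
  have h2 := hc hb he (a := s / (d + s)) (b := d / (d + s)) (by positivity) (by positivity)
    (by field_simp; ring)
  simp only [smul_eq_mul] at h1 h2
  have e1 : (d / (d + s) * b + s / (d + s) * (b + d + s) : ℝ) = b + s := by field_simp; ring
  have e2 : (s / (d + s) * b + d / (d + s) * (b + d + s) : ℝ) = b + d := by field_simp; ring
  rw [e1] at h1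
  rw [e2] at h2
  have e3 : (d / (d + s) : ℝ) = 1 - s / (d + s) := by field_simp; ring
  rw [e3] at h1 h2
  have : ((b + d + s : ℝ) ^ q + (b : ℝ) ^ q) ≤ (b + s : ℝ) ^ q + (b + d : ℝ) ^ q := by
    linarith
  exact_mod_cast this

lemma rpow_add_rpow_tsub_le {q : ℝ} (hq : 1 ≤ q) (D s : ℝ≥0) :
    (D + s) ^ q + (D - 2 ^ q * s) ^ q ≤
      2 * D ^ q + ((2 ^ q + 1) ^ q + (2 ^ q) ^ q) * s ^ q := by
  have hq0 : 0 ≤ q := by linarith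
  rcases le_total D (2 ^ q * s) with h | h
  · have h1 : (D + s) ^ q ≤ (2 ^ q + 1) ^ q * s ^ q := by
      rw [← NNReal.mul_rpow]
      gcongr
      rw [add_mul, one_mul]
      gcongr
    have h2 : (D - 2 ^ q * s) ^ q = 0 := by
      rw [tsub_eq_zero_of_le h, NNReal.zero_rpow (by linarith)]
    rw [h2, add_zero, add_mul]
    exact le_add_left (le_add_right h1)
  · refine le_add_right ?_
    rcases eq_or_ne D 0 with rfl | hD
    · have : s = 0 := by
        have h2 : (0 : ℝ≥0) < 2 ^ q := by positivity
        simpa [h2.ne'] using h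
      subst this
      simp [NNReal.zero_rpow (show q ≠ 0 by linarith)]
    obtain ⟨u, rfl⟩ : ∃ u, s = D * u := ⟨s / D, by field_simp⟩
    have hu : 2 ^ q * u ≤ 1 := by
      have : D * (2 ^ q * u) ≤ D * 1 := by convert h using 1 <;> ring
      exact le_of_mul_le_mul_left this (pos_iff_ne_zero.2 hD)
    have e1 : D + D * u = D * (1 + u) := by ring
    have e2 : D - 2 ^ q * (D * u) = D * (1 - 2 ^ q * u) := by
      rw [mul_tsub, mul_one]; congr 1; ring
    rw [e1, e2, NNReal.mul_rpow, NNReal.mul_rpow, ← mul_add, mul_comm]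
    gcongr
    have h1q : (1 : ℝ≥0) ≤ 2 ^ q := NNReal.one_le_rpow (by norm_num) hq0
    have hu1 : u ≤ 1 := (le_mul_of_one_le_left' h1q).trans hu
    have h3 : (1 - 2 ^ q * u) ^ q ≤ 1 - 2 ^ q * u :=
      NNReal.rpow_le_self_of_le_one tsub_le_self hq
    have h4 : (1 + u) ^ q ≤ 1 + 2 ^ q * u := by
      have hconv := (convexOn_rpow hq).2
      have hc := hconv (Set.mem_Ici.2 (zero_le_one' ℝ))
        (Set.mem_Ici.2 (zero_le_two (α := ℝ))) (a := 1 - (u : ℝ)) (b := (u : ℝ))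
        (by simpa using hu1) u.2 (by ring)
      simp only [smul_eq_mul, Real.one_rpow] at hc
      have e : ((1 - u) * 1 + u * 2 : ℝ) = 1 + u := by ring
      rw [e] at hc
      have : (1 + u : ℝ) ^ q ≤ 1 + (2 : ℝ) ^ q * u := by
        have := u.2
        linarith
      exact_mod_cast this
    calc _ ≤ (1 + 2 ^ q * u) + (1 - 2 ^ q * u) := add_le_add h4 h3
      _ = 2 := by rw [add_assoc, add_tsub_cancel_of_le hu]; norm_num

lemma tsub_rpow_symm_le {q : ℝ} (hq : 1 ≤ q) (a b s t : ℝ≥0) (hts : t ≤ s) :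
    (a + s - (2 ^ q + 1) * (b + t)) ^ q + (a + t - (2 ^ q + 1) * (b + s)) ^ q ≤
      2 * (a - (2 ^ q + 1) * b) ^ q + ((2 ^ q + 1) ^ q + (2 ^ q) ^ q) * s ^ q := by
  have hq0 : 0 ≤ q := by linarith
  refine le_trans (add_le_add ?_ ?_) (rpow_add_rpow_tsub_le hq (a - (2 ^ q + 1) * b) s)
  · gcongr
    rw [tsub_le_iff_right]
    calc a + s ≤ (a - (2 ^ q + 1) * b + (2 ^ q + 1) * b) + s := by gcongr; exact le_tsub_add
      _ ≤ _ := by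
        rw [add_right_comm]
        gcongr
        exact le_self_add
  · refine NNReal.rpow_le_rpow ?_ hq0
    rw [tsub_tsub, tsub_le_iff_right]
    calc a + t ≤ (a - ((2 ^ q + 1) * b + 2 ^ q * s) + ((2 ^ q + 1) * b + 2 ^ q * s)) + s := by
          gcongr; exact le_tsub_add
      _ = _ := by ring

/-- A two-variable majorant which decreases on average along exchangeable increments. -/
lemma exists_exchangeable_majorant {q : ℝ} (hq : 0 < q) :
    ∃ (P : ℝ≥0 → ℝ≥0 → ℝ≥0) (c d : ℝ≥0), Measurable (Function.uncurry P) ∧ P 0 0 = 0 ∧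
      (∀ a b s t, P (a + s) (b + t) + P (a + t) (b + s) + 2 * (c * b ^ q) ≤
        c * (b + t) ^ q + c * (b + s) ^ q + 2 * P a b) ∧
      ∀ a b, a ^ q ≤ d * (P a b + b ^ q) := by
  rcases le_total q 1 with hq1 | hq1
  · refine ⟨fun a b => (a + b) ^ q, 2, 1, by unfold Function.uncurry; fun_prop,
      by simp [hq.ne'], fun a b s t => ?_, fun a b => ?_⟩
    · have h1 := add_rpow_add_rpow_le_of_le_one hq.le hq1 b (a + s) t
      have h2 := add_rpow_add_rpow_le_of_le_one hq.le hq1 b a s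
      have e1 : a + s + (b + t) = b + (a + s) + t := by ring
      have e2 : a + t + (b + s) = b + (a + s) + t := by ring
      have e3 : b + (a + s) = b + a + s := by ring
      have e4 : a + b = b + a := by ring
      simp only [e1, e2, e4]
      rw [e3] at h1 ⊢
      calc _ = 2 * (((b + a + s + t) ^ q + b ^ q) + b ^ q) := by ring
        _ ≤ 2 * ((b + t) ^ q + (b + a + s) ^ q + b ^ q) :=
          mul_le_mul_right (add_le_add_left h1 _) 2
        _ = 2 * ((b + t) ^ q + ((b + a + s) ^ q + b ^ q)) := by ring
        _ ≤ 2 * ((b + t) ^ q + ((b + s) ^ q + (b + a) ^ q)) :=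
          mul_le_mul_right (add_le_add_right h2 _) 2
        _ = _ := by ring
    · rw [one_mul]
      exact le_add_right (NNReal.rpow_le_rpow le_self_add hq.le)
  · set c : ℝ≥0 := (2 ^ q + 1) ^ q + (2 ^ q) ^ q with hc
    refine ⟨fun a b => (a - (2 ^ q + 1) * b) ^ q, c, 2 ^ q * (1 + (2 ^ q + 1) ^ q),
      by unfold Function.uncurry; fun_prop, by simp [hq.ne'], fun a b s t => ?_, fun a b => ?_⟩
    · have key : (a + s - (2 ^ q + 1) * (b + t)) ^ q + (a + t - (2 ^ q + 1) * (b + s)) ^ q ≤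
          2 * (a - (2 ^ q + 1) * b) ^ q + c * (s ^ q + t ^ q) := by
        rcases le_total t s with h | h
        · refine (tsub_rpow_symm_le hq1 a b s t h).trans ?_
          gcongr
          exact le_self_add
        · rw [add_comm]
          refine (tsub_rpow_symm_le hq1 a b t s h).trans ?_
          gcongr
          exact le_add_self
      have h1 := NNReal.add_rpow_le_rpow_add b t hq1
      have h2 := NNReal.add_rpow_le_rpow_add b s hq1
      calc _ ≤ 2 * (a - (2 ^ q + 1) * b) ^ q + c * (s ^ q + t ^ q) + 2 * (c * b ^ q) := by gcongr
        _ = c * (b ^ q + t ^ q) + c * (b ^ q + s ^ q) + 2 * (a - (2 ^ q + 1) * b) ^ q := by ring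
        _ ≤ _ := by gcongr
    · set D := a - (2 ^ q + 1) * b
      have h1 : a ≤ D + (2 ^ q + 1) * b := le_tsub_add
      have h2 : ∀ x y : ℝ≥0, (x + y) ^ q ≤ 2 ^ q * (x ^ q + y ^ q) := fun x y => by
        have : x + y ≤ 2 * max x y := by
          rw [two_mul]; exact add_le_add (le_max_left _ _) (le_max_right _ _)
        calc (x + y) ^ q ≤ (2 * max x y) ^ q := by gcongr
          _ = 2 ^ q * max x y ^ q := NNReal.mul_rpow
          _ ≤ _ := by
            gcongr
            rcases max_cases x y with ⟨h, _⟩ | ⟨h, _⟩ <;> rw [h]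
            exacts [le_self_add, le_add_self]
      calc a ^ q ≤ (D + (2 ^ q + 1) * b) ^ q := by gcongr
        _ ≤ 2 ^ q * (D ^ q + ((2 ^ q + 1) * b) ^ q) := h2 _ _
        _ = 2 ^ q * (1 * D ^ q + (2 ^ q + 1) ^ q * b ^ q) := by rw [NNReal.mul_rpow, one_mul]
        _ ≤ 2 ^ q * ((1 + (2 ^ q + 1) ^ q) * D ^ q + (1 + (2 ^ q + 1) ^ q) * b ^ q) := by
          gcongr
          exacts [le_self_add, le_add_self]
        _ = _ := by ring

/-- The normalised sum over all choices of signs. -/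
def signMean {κ : Type*} [Fintype κ] [DecidableEq κ] (F : (κ → Bool) → ℝ) : ℝ :=
  ((2 : ℝ) ^ Fintype.card κ)⁻¹ * ∑ ε, F ε

section Khintchine

variable {κ : Type*} [Fintype κ] [DecidableEq κ]

lemma signMean_mono {F F' : (κ → Bool) → ℝ} (h : ∀ ε, F ε ≤ F' ε) : signMean F ≤ signMean F' := by
  unfold signMean
  gcongr with ε
  exact h ε

lemma signMean_add (F F' : (κ → Bool) → ℝ) :
    signMean (fun ε => F ε + F' ε) = signMean F + signMean F' := by
  simp only [signMean, Finset.sum_add_distrib, mul_add]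

lemma signMean_const_mul (r : ℝ) (F : (κ → Bool) → ℝ) :
    signMean (fun ε => r * F ε) = r * signMean F := by
  simp only [signMean, ← Finset.mul_sum]; ring

lemma signMean_const (r : ℝ) : signMean (fun _ : κ → Bool => r) = r := by
  simp [signMean]

lemma signMean_sum {ι : Type*} (s : Finset ι) (F : ι → (κ → Bool) → ℝ) :
    signMean (fun ε => ∑ i ∈ s, F i ε) = ∑ i ∈ s, signMean (F i) := by
  simp only [signMean]
  rw [Finset.sum_comm, Finset.mul_sum]

lemma signMean_prod (φ : κ → Bool → ℝ) :
    signMean (fun ε => ∏ k, φ k (ε k)) = ∏ k, ((φ k true + φ k false) / 2) := by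
  simp only [signMean, Finset.prod_div_distrib, Finset.prod_const, Finset.card_univ]
  have h := Finset.prod_univ_sum (fun _ : κ => (Finset.univ : Finset Bool)) φ
  simp only [Fintype.univ_bool, Finset.mem_singleton, Bool.true_eq_false, not_false_eq_true,
    Finset.sum_insert, Finset.sum_singleton] at h
  rw [h, div_eq_inv_mul]
  congr 1

lemma signMean_sgnB_mul (i j : κ) :
    signMean (fun ε => sgnB (ε i) * sgnB (ε j)) = if i = j then 1 else 0 := by
  split_ifs with h
  · subst h
    have : ∀ b, sgnB b * sgnB b = 1 := by intro b; cases b <;> simp [sgnB]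
    simp only [this, signMean_const]
  · set φ : κ → Bool → ℝ := fun k b => (if k = i then sgnB b else 1) * if k = j then sgnB b else 1
      with hφ
    have h1 : ∀ ε : κ → Bool, sgnB (ε i) * sgnB (ε j) = ∏ k, φ k (ε k) := by
      intro ε
      simp only [hφ, Finset.prod_mul_distrib, Finset.prod_ite_eq', Finset.mem_univ, if_true]
    simp only [h1]
    rw [signMean_prod φ]
    refine Finset.prod_eq_zero (Finset.mem_univ i) ?_
    simp [hφ, h, sgnB]

lemma signMean_sq (a : κ → ℝ) :
    signMean (fun ε => (∑ k, sgnB (ε k) * a k) ^ 2) = ∑ k, a k ^ 2 := by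
  have h : ∀ ε : κ → Bool, (∑ k, sgnB (ε k) * a k) ^ 2 =
      ∑ i, ∑ j, a i * a j * (sgnB (ε i) * sgnB (ε j)) := by
    intro ε
    rw [sq, Finset.sum_mul_sum]
    exact Finset.sum_congr rfl fun i _ => Finset.sum_congr rfl fun j _ => by ring
  simp only [h, signMean_sum, signMean_const_mul, signMean_sgnB_mul]
  simp [sq]

lemma signMean_exp_le (a : κ → ℝ) :
    signMean (fun ε => Real.exp (∑ k, sgnB (ε k) * a k)) ≤ Real.exp ((∑ k, a k ^ 2) / 2) := by
  simp only [Real.exp_sum]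
  rw [signMean_prod (fun k b => Real.exp (sgnB b * a k)), Finset.sum_div, Real.exp_sum]
  refine Finset.prod_le_prod (fun _ _ => by positivity) fun k _ => ?_
  have := Real.cosh_le_exp_half_sq (a k)
  rw [Real.cosh_eq] at this
  simpa [sgnB] using this

lemma abs_rpow_le_exp_add_exp {p : ℝ} (hp : 0 < p) (x : ℝ) :
    |x| ^ p ≤ p ^ p * (Real.exp x + Real.exp (-x)) := by
  have h1 : |x| / p ≤ Real.exp (|x| / p) := by linarith [Real.add_one_le_exp (|x| / p)]
  have h2 : (|x| / p) ^ p ≤ Real.exp |x| := by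
    calc (|x| / p) ^ p ≤ Real.exp (|x| / p) ^ p := by gcongr
      _ = Real.exp |x| := by rw [← Real.exp_mul]; congr 1; field_simp
  have h3 : Real.exp |x| ≤ Real.exp x + Real.exp (-x) := by
    rcases abs_cases x with ⟨h, _⟩ | ⟨h, _⟩ <;> rw [h] <;>
      linarith [Real.exp_pos x, Real.exp_pos (-x)]
  calc |x| ^ p = p ^ p * (|x| / p) ^ p := by
        rw [← Real.mul_rpow hp.le (by positivity)]; congr 1; field_simp
    _ ≤ _ := by gcongr; exact h2.trans h3

lemma signMean_abs_rpow_le {p : ℝ} (hp : 0 < p) (a : κ → ℝ) (ha : ∑ k, a k ^ 2 = 1) :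
    signMean (fun ε => |∑ k, sgnB (ε k) * a k| ^ p) ≤ p ^ p * (2 * Real.exp (1 / 2)) := by
  refine (signMean_mono fun ε => abs_rpow_le_exp_add_exp hp _).trans ?_
  rw [signMean_const_mul, signMean_add]
  gcongr
  have h1 := signMean_exp_le a
  have h2 := signMean_exp_le (fun k => -a k)
  simp only [mul_neg, Finset.sum_neg_distrib, even_two, Even.neg_pow, ha] at h1 h2
  linarith

lemma sq_le_add_rpow_add_pow_four {p : ℝ} (hp : 0 < p) {M : ℝ} (hM : 0 < M) (x : ℝ) :
    x ^ 2 ≤ 1 / 4 + M * 2 ^ p * |x| ^ p + x ^ 4 / M := by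
  have h0 : 0 ≤ M * 2 ^ p * |x| ^ p := by positivity
  have h1 : 0 ≤ x ^ 4 / M := by positivity
  rcases le_total |x| (1 / 2) with h | h
  · have : x ^ 2 ≤ (1 / 2) ^ 2 := by rw [← sq_abs]; gcongr
    linarith
  rcases le_total (x ^ 2) M with h' | h'
  · have : 1 ≤ (2 : ℝ) ^ p * |x| ^ p := by
      rw [← Real.mul_rpow (by norm_num) (by positivity)]
      exact Real.one_le_rpow (by linarith) hp.le
    nlinarith
  · have : x ^ 2 ≤ x ^ 4 / M := by
      rw [le_div_iff₀ hM]
      nlinarith [sq_nonneg x]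
    linarith

lemma exists_le_signMean_abs_rpow {p : ℝ} (hp : 0 < p) :
    ∃ c : ℝ, 0 < c ∧ ∀ {κ : Type} [Fintype κ] [DecidableEq κ] (a : κ → ℝ), ∑ k, a k ^ 2 = 1 →
      c ≤ signMean (fun ε => |∑ k, sgnB (ε k) * a k| ^ p) := by
  set B : ℝ := 4 ^ (4 : ℝ) * (2 * Real.exp (1 / 2)) with hB
  have hB0 : 0 < B := by positivity
  refine ⟨(4 * B * 2 ^ p)⁻¹ / 2, by positivity, fun a ha => ?_⟩
  have h1 := signMean_sq a
  have h2 := signMean_abs_rpow_le (p := 4) (by norm_num) a ha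
  have h3 := signMean_mono fun ε => sq_le_add_rpow_add_pow_four hp
    (show 0 < 4 * B by positivity) (∑ k, sgnB (ε k) * a k)
  have h4 : ∀ x : ℝ, x ^ 4 / (4 * B) = (4 * B)⁻¹ * |x| ^ (4 : ℝ) := by
    intro x
    have : |x| ^ (4 : ℝ) = |x| ^ (4 : ℕ) := by exact_mod_cast Real.rpow_natCast |x| 4
    rw [this, Even.pow_abs (by decide)]; field_simp
  simp only [h4] at h3
  rw [signMean_add, signMean_add, signMean_const, signMean_const_mul, signMean_const_mul, h1, ha]
    at h3
  have h5 : (4 * B)⁻¹ * signMean (fun ε => |∑ k, sgnB (ε k) * a k| ^ (4 : ℝ)) ≤ 1 / 4 := by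
    calc _ ≤ (4 * B)⁻¹ * B := by gcongr
      _ = 1 / 4 := by field_simp
  rw [div_le_iff₀ (by norm_num), inv_le_iff_one_le_mul₀ (by positivity)]
  linarith

/-- Khintchine's inequality. -/
lemma exists_khintchine {q : ℝ} (hq : 0 < q) :
    ∃ c C : ℝ, 0 < c ∧ 0 < C ∧ ∀ {κ : Type} [Fintype κ] [DecidableEq κ] (a : κ → ℝ),
      c * (∑ k, a k ^ 2) ^ q ≤ signMean (fun ε => |∑ k, sgnB (ε k) * a k| ^ (2 * q)) ∧
      signMean (fun ε => |∑ k, sgnB (ε k) * a k| ^ (2 * q)) ≤ C * (∑ k, a k ^ 2) ^ q := by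
  have hp : 0 < 2 * q := by linarith
  obtain ⟨c, hc, hc'⟩ := exists_le_signMean_abs_rpow hp
  refine ⟨c, (2 * q) ^ (2 * q) * (2 * Real.exp (1 / 2)), hc, by positivity, fun {κ} _ _ a => ?_⟩
  have hS : 0 ≤ ∑ k, a k ^ 2 := Finset.sum_nonneg fun _ _ => sq_nonneg _
  rcases hS.eq_or_lt with h0 | hpos
  · have : ∀ k, a k = 0 := fun k => by
      have := (Finset.sum_eq_zero_iff_of_nonneg fun k _ => sq_nonneg (a k)).1 h0.symm k
        (Finset.mem_univ k)
      simpa using this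
    simp [this, signMean_const, hq.ne', Real.zero_rpow]
  · set r := Real.sqrt (∑ k, a k ^ 2) with hr
    have hr0 : 0 < r := Real.sqrt_pos.2 hpos
    have hr2 : r ^ 2 = ∑ k, a k ^ 2 := Real.sq_sqrt hS
    have hn : ∑ k, (a k / r) ^ 2 = 1 := by
      simp only [div_pow, ← Finset.sum_div]
      rw [hr2, div_self hpos.ne']
    have hrq : r ^ (2 * q) = (∑ k, a k ^ 2) ^ q := by
      rw [← hr2, Real.rpow_mul hr0.le]; norm_num
    have hscale : signMean (fun ε => |∑ k, sgnB (ε k) * a k| ^ (2 * q)) =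
        (∑ k, a k ^ 2) ^ q * signMean (fun ε => |∑ k, sgnB (ε k) * (a k / r)| ^ (2 * q)) := by
      rw [← signMean_const_mul]
      congr 1
      ext ε
      rw [← hrq, ← Real.mul_rpow hr0.le (abs_nonneg _)]
      congr 1
      rw [← abs_of_pos hr0, ← abs_mul, abs_of_pos hr0, Finset.mul_sum]
      congr 1
      refine Finset.sum_congr rfl fun k _ => ?_
      field_simp
    have h1 := hc' _ hn
    have h2 := signMean_abs_rpow_le hp _ hn
    have h3 : 0 ≤ (∑ k, a k ^ 2) ^ q := by positivity
    rw [hscale, mul_comm c, mul_comm _ ((∑ k, a k ^ 2) ^ q)]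
    exact ⟨mul_le_mul_of_nonneg_left h1 h3, mul_le_mul_of_nonneg_left h2 h3⟩

end Khintchine

section Decoupling

variable {E ι : Type} [MeasurableSpace E]

/-- The sum of the functions `g i`, `i ∈ H`. -/
def partialSum (g : ι → E → ℝ≥0) (H : Finset ι) (x : E) : ℝ≥0 := ∑ i ∈ H, g i x

/-- The decoupled version of `partialSum`. -/
def decoupledSum (A : ι → Set E) (g : ι → E → ℝ≥0) (H : Finset ι) (x : E) (y : ι → E) : ℝ≥0 :=
  ∑ i ∈ H, (A i).indicator (fun _ => g i (y i)) x

lemma measurable_partialSum {g : ι → E → ℝ≥0} (hg : ∀ i, Measurable (g i)) (H : Finset ι) :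
    Measurable (partialSum g H) :=
  Finset.measurable_fun_sum H fun i _ => hg i

lemma measurable_decoupledSum {A : ι → Set E} (hA : ∀ i, MeasurableSet (A i))
    {g : ι → E → ℝ≥0} (hg : ∀ i, Measurable (g i)) (H : Finset ι) :
    Measurable fun p : E × (ι → E) => decoupledSum A g H p.1 p.2 := by
  refine Finset.measurable_fun_sum H fun i _ => ?_
  exact ((hg i).comp ((measurable_pi_apply i).comp measurable_snd)).indicator
    (measurable_fst (hA i))

variable [Fintype ι] [DecidableEq ι]

lemma lintegral_pi_eq_lintegral_update (ν : ι → Measure E) [∀ i, IsProbabilityMeasure (ν i)]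
    (i : ι) {F : (ι → E) → ℝ≥0∞} (hF : Measurable F) :
    ∫⁻ y, F y ∂Measure.pi ν = ∫⁻ y, ∫⁻ z, F (Function.update y i z) ∂ν i ∂Measure.pi ν := by
  have hm : Measurable fun p : (ι → E) × E => F (Function.update p.1 i p.2) :=
    hF.comp measurable_update'
  refine lintegral_eq_of_lmarginal_eq {i} hF hm.lintegral_prod_right' ?_
  rw [lmarginal_singleton, lmarginal_singleton]
  simp

/-- The double integral of `Q` evaluated at the partial sums over `H`. -/
def sumLIntegral (μ : Measure E) (ν : ι → Measure E) (A : ι → Set E) (g : ι → E → ℝ≥0)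
    (Q : ℝ≥0 → ℝ≥0 → ℝ≥0) (H : Finset ι) (s : Set E) : ℝ≥0∞ :=
  ∫⁻ x in s, ∫⁻ y, Q (partialSum g H x) (decoupledSum A g H x y) ∂Measure.pi ν ∂μ

/-- Averaging of a symmetrised inequality over independent copies. -/
lemma lintegral_lintegral_add_le (ν : Measure E) [IsProbabilityMeasure ν] {g : E → ℝ≥0}
    (hg : Measurable g) {P N : ℝ≥0 → ℝ≥0 → ℝ≥0} (hP : Measurable (Function.uncurry P))
    (hN : Measurable (Function.uncurry N))
    (hPN : ∀ a b s t, P (a + s) (b + t) + P (a + t) (b + s) + 2 * N a b ≤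
      N (a + s) (b + t) + N (a + t) (b + s) + 2 * P a b) (a b : ℝ≥0) :
    ∫⁻ x, ∫⁻ z, P (a + g x) (b + g z) ∂ν ∂ν + N a b ≤
      ∫⁻ x, ∫⁻ z, N (a + g x) (b + g z) ∂ν ∂ν + P a b := by
  have hQ : ∀ {Q : ℝ≥0 → ℝ≥0 → ℝ≥0}, Measurable (Function.uncurry Q) →
      Measurable fun p : E × E => (Q (a + g p.1) (b + g p.2) : ℝ≥0∞) := fun {Q} hQ =>
    (hQ.comp ((measurable_const.add (hg.comp measurable_fst)).prodMk
      (measurable_const.add (hg.comp measurable_snd)))).coe_nnreal_ennreal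
  have hsymm : ∀ {Q : ℝ≥0 → ℝ≥0 → ℝ≥0}, Measurable (Function.uncurry Q) → ∀ r : ℝ≥0,
      ∫⁻ x, ∫⁻ z, ((Q (a + g x) (b + g z) + Q (a + g z) (b + g x) + 2 * r : ℝ≥0) : ℝ≥0∞) ∂ν ∂ν =
        2 * (∫⁻ x, ∫⁻ z, Q (a + g x) (b + g z) ∂ν ∂ν + r) := by
    intro Q hQm r
    have h1 := hQ hQm
    have h2 := h1.comp measurable_swap
    simp only [ENNReal.coe_add]
    refine (lintegral_prod (μ := ν) (ν := ν) (fun p : E × E => (Q (a + g p.1) (b + g p.2) : ℝ≥0∞) +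
      Q (a + g p.2) (b + g p.1) + (2 * r : ℝ≥0)) ((h1.add h2).add_const _).aemeasurable).symm.trans ?_
    rw [lintegral_add_right _ measurable_const, lintegral_add_left h1]
    have h3 : ∫⁻ p : E × E, (Q (a + g p.2) (b + g p.1) : ℝ≥0∞) ∂ν.prod ν =
        ∫⁻ p : E × E, (Q (a + g p.1) (b + g p.2) : ℝ≥0∞) ∂ν.prod ν :=
      lintegral_prod_swap (μ := ν) (ν := ν) fun p : E × E => (Q (a + g p.1) (b + g p.2) : ℝ≥0∞)
    rw [h3, lintegral_prod _ h1.aemeasurable]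
    simp only [lintegral_const, measure_univ, mul_one, ENNReal.coe_mul, ENNReal.coe_ofNat]
    ring
  have h := lintegral_mono (μ := ν) fun x => lintegral_mono (μ := ν) fun z =>
    ENNReal.coe_le_coe.2 (hPN a b (g x) (g z))
  rw [hsymm hP, hsymm hN] at h
  exact (ENNReal.mul_le_mul_iff_right (by norm_num) (by norm_num)).1 h

variable {μ : Measure E} {A : ι → Set E} {g : ι → E → ℝ≥0}

lemma isProbabilityMeasure_inv_smul_restrict {s : Set E} (h0 : 0 < μ s) (h1 : μ s < ⊤) :
    IsProbabilityMeasure ((μ s)⁻¹ • μ.restrict s) :=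
  ⟨by simp [ENNReal.inv_mul_cancel h0.ne' h1.ne]⟩

/-- Adding one set of maximal level. -/
lemma sumLIntegral_insert_add_le (hA : ∀ i, MeasurableSet (A i)) (hA0 : ∀ i, 0 < μ (A i))
    (hA1 : ∀ i, μ (A i) < ⊤) (hg : ∀ i, Measurable (g i)) (hgA : ∀ i, ∀ x ∉ A i, g i x = 0)
    {H : Finset ι} {j : ι} (hj : j ∉ H)
    (hH : ∀ i ∈ H, ∀ x ∈ A j, ∀ x' ∈ A j, g i x = g i x' ∧ (x ∈ A i ↔ x' ∈ A i))
    {P N : ℝ≥0 → ℝ≥0 → ℝ≥0} (hP : Measurable (Function.uncurry P))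
    (hN : Measurable (Function.uncurry N))
    (hPN : ∀ a b s t, P (a + s) (b + t) + P (a + t) (b + s) + 2 * N a b ≤
      N (a + s) (b + t) + N (a + t) (b + s) + 2 * P a b) :
    sumLIntegral μ (fun i => (μ (A i))⁻¹ • μ.restrict (A i)) A g P (insert j H) Set.univ +
      sumLIntegral μ (fun i => (μ (A i))⁻¹ • μ.restrict (A i)) A g N H Set.univ ≤
    sumLIntegral μ (fun i => (μ (A i))⁻¹ • μ.restrict (A i)) A g N (insert j H) Set.univ +
      sumLIntegral μ (fun i => (μ (A i))⁻¹ • μ.restrict (A i)) A g P H Set.univ := by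
  set ν : ι → Measure E := fun i => (μ (A i))⁻¹ • μ.restrict (A i) with hν
  have hprob : ∀ i, IsProbabilityMeasure (ν i) := fun i =>
    isProbabilityMeasure_inv_smul_restrict (hA0 i) (hA1 i)
  obtain ⟨x₀, hx₀⟩ : (A j).Nonempty := nonempty_of_measure_ne_zero (hA0 j).ne'
  set a := partialSum g H x₀
  set τ := decoupledSum A g H x₀
  have hS : ∀ x ∈ A j, partialSum g H x = a := fun x hx =>
    Finset.sum_congr rfl fun i hi => (hH i hi x hx x₀ hx₀).1
  have hT : ∀ x ∈ A j, decoupledSum A g H x = τ := fun x hx => by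
    ext1 y
    refine Finset.sum_congr rfl fun i hi => ?_
    by_cases h : x ∈ A i
    · rw [Set.indicator_of_mem h, Set.indicator_of_mem ((hH i hi x hx x₀ hx₀).2.1 h)]
    · rw [Set.indicator_of_notMem h,
        Set.indicator_of_notMem fun h' => h ((hH i hi x hx x₀ hx₀).2.2 h')]
  have hτ : Measurable τ :=
    (measurable_decoupledSum hA hg H).comp (measurable_const.prodMk measurable_id)
  have hτu : ∀ y z, τ (Function.update y j z) = τ y := fun y z =>
    Finset.sum_congr rfl fun i hi => by
      rw [Function.update_of_ne (ne_of_mem_of_not_mem hi hj)]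
  have hsplit : ∀ Q K, sumLIntegral μ ν A g Q K Set.univ =
      sumLIntegral μ ν A g Q K (A j) + sumLIntegral μ ν A g Q K (A j)ᶜ := fun Q K => by
    simp only [sumLIntegral, Measure.restrict_univ]
    exact (lintegral_add_compl _ (hA j)).symm
  have hcompl : ∀ Q, sumLIntegral μ ν A g Q (insert j H) (A j)ᶜ =
      sumLIntegral μ ν A g Q H (A j)ᶜ := fun Q =>
    setLIntegral_congr_fun (hA j).compl fun x hx => by
      have hx' : x ∉ A j := hx
      simp [partialSum, decoupledSum, Finset.sum_insert hj, hgA j x hx', hx']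
  have hold : ∀ Q, sumLIntegral μ ν A g Q H (A j) = μ (A j) * ∫⁻ y, Q a (τ y) ∂Measure.pi ν := by
    intro Q
    rw [mul_comm, ← setLIntegral_const]
    exact setLIntegral_congr_fun (hA j) fun x hx => by simp only [hS x hx, hT x hx]
  have hnew : ∀ {Q : ℝ≥0 → ℝ≥0 → ℝ≥0}, Measurable (Function.uncurry Q) →
      sumLIntegral μ ν A g Q (insert j H) (A j) = μ (A j) * ∫⁻ y,
        ∫⁻ x, ∫⁻ z, Q (a + g j x) (τ y + g j z) ∂ν j ∂ν j ∂Measure.pi ν := by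
    intro Q hQ
    have hrestr : μ.restrict (A j) = μ (A j) • ν j := by
      rw [hν, smul_smul, ENNReal.mul_inv_cancel (hA0 j).ne' (hA1 j).ne, one_smul]
    have hcongr : sumLIntegral μ ν A g Q (insert j H) (A j) =
        ∫⁻ x in A j, ∫⁻ y, Q (a + g j x) (τ y + g j (y j)) ∂Measure.pi ν ∂μ :=
      setLIntegral_congr_fun (hA j) fun x hx => by
        have h1 : partialSum g (insert j H) x = a + g j x := by
          rw [← hS x hx, add_comm]; exact Finset.sum_insert hj
        have h2 : ∀ y, decoupledSum A g (insert j H) x y = τ y + g j (y j) := fun y => by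
          rw [← hT x hx, add_comm]
          refine (Finset.sum_insert hj).trans ?_
          rw [Set.indicator_of_mem hx]
          rfl
        simp only [h1, h2]
    have hresample : ∀ x, ∫⁻ y, (Q (a + g j x) (τ y + g j (y j)) : ℝ≥0∞) ∂Measure.pi ν =
        ∫⁻ y, ∫⁻ z, Q (a + g j x) (τ y + g j z) ∂ν j ∂Measure.pi ν := fun x => by
      have hm : Measurable fun y : ι → E => (Q (a + g j x) (τ y + g j (y j)) : ℝ≥0∞) :=
        (hQ.comp (measurable_const.prodMk
          (hτ.add ((hg j).comp (measurable_pi_apply j))))).coe_nnreal_ennreal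
      rw [lintegral_pi_eq_lintegral_update ν j hm]
      simp only [hτu, Function.update_self]
    rw [hcongr, hrestr, lintegral_smul_measure, smul_eq_mul]
    simp only [hresample]
    rw [lintegral_lintegral_swap]
    have hm : Measurable fun p : (E × (ι → E)) × E =>
        (Q (a + g j p.1.1) (τ p.1.2 + g j p.2) : ℝ≥0∞) :=
      (hQ.comp ((measurable_const.add ((hg j).comp (measurable_fst.comp measurable_fst))).prodMk
        ((hτ.comp (measurable_snd.comp measurable_fst)).add
          ((hg j).comp measurable_snd)))).coe_nnreal_ennreal
    exact hm.lintegral_prod_right'.aemeasurable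
  have hmain : sumLIntegral μ ν A g P (insert j H) (A j) + sumLIntegral μ ν A g N H (A j) ≤
      sumLIntegral μ ν A g N (insert j H) (A j) + sumLIntegral μ ν A g P H (A j) := by
    have hQτ : ∀ {Q : ℝ≥0 → ℝ≥0 → ℝ≥0}, Measurable (Function.uncurry Q) →
        Measurable fun y => (Q a (τ y) : ℝ≥0∞) := fun hQ =>
      (hQ.comp (measurable_const.prodMk hτ)).coe_nnreal_ennreal
    rw [hnew hP, hnew hN, hold, hold, ← mul_add, ← mul_add, ← lintegral_add_right _ (hQτ hP),
      ← lintegral_add_right _ (hQτ hN)]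
    refine mul_le_mul_right (lintegral_mono fun y => ?_) _
    exact lintegral_lintegral_add_le (ν j) (hg j) hP hN hPN a (τ y)
  rw [hsplit P, hsplit N, hsplit N, hsplit P, hcompl, hcompl]
  calc _ = (sumLIntegral μ ν A g P (insert j H) (A j) + sumLIntegral μ ν A g N H (A j)) +
        (sumLIntegral μ ν A g P H (A j)ᶜ + sumLIntegral μ ν A g N H (A j)ᶜ) := by ring
    _ ≤ (sumLIntegral μ ν A g N (insert j H) (A j) + sumLIntegral μ ν A g P H (A j)) +
        (sumLIntegral μ ν A g P H (A j)ᶜ + sumLIntegral μ ν A g N H (A j)ᶜ) := by gcongr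
    _ = _ := by ring

lemma sumLIntegral_le_of_symm_le (ℓ : ι → ℤ) (hA : ∀ i, MeasurableSet (A i))
    (hA0 : ∀ i, 0 < μ (A i)) (hA1 : ∀ i, μ (A i) < ⊤) (hg : ∀ i, Measurable (g i))
    (hgA : ∀ i, ∀ x ∉ A i, g i x = 0)
    (hℓ : ∀ i j, i ≠ j → ℓ i ≤ ℓ j →
      ∀ x ∈ A j, ∀ x' ∈ A j, g i x = g i x' ∧ (x ∈ A i ↔ x' ∈ A i))
    {P N : ℝ≥0 → ℝ≥0 → ℝ≥0} (hP : Measurable (Function.uncurry P))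
    (hN : Measurable (Function.uncurry N)) (hP0 : P 0 0 = 0)
    (hNmono : ∀ a a' b b', a ≤ a' → b ≤ b' → N a b ≤ N a' b')
    (hPN : ∀ a b s t, P (a + s) (b + t) + P (a + t) (b + s) + 2 * N a b ≤
      N (a + s) (b + t) + N (a + t) (b + s) + 2 * P a b) (H : Finset ι) :
    sumLIntegral μ (fun i => (μ (A i))⁻¹ • μ.restrict (A i)) A g P H Set.univ ≤
      sumLIntegral μ (fun i => (μ (A i))⁻¹ • μ.restrict (A i)) A g N H Set.univ := by
  induction H using Finset.induction_on_max_value ℓ with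
  | empty => simp [sumLIntegral, partialSum, decoupledSum, hP0]
  | insert j H hj hmax ih =>
    have hstep := sumLIntegral_insert_add_le hA hA0 hA1 hg hgA hj
      (fun i hi => hℓ i j (ne_of_mem_of_not_mem hi hj) (hmax i hi)) hP hN hPN
    have hle : sumLIntegral μ (fun i => (μ (A i))⁻¹ • μ.restrict (A i)) A g N H Set.univ ≤
        sumLIntegral μ (fun i => (μ (A i))⁻¹ • μ.restrict (A i)) A g N (insert j H)
          Set.univ := by
      refine lintegral_mono fun x => lintegral_mono fun y => ENNReal.coe_le_coe.2 ?_
      exact hNmono _ _ _ _ (Finset.sum_le_sum_of_subset (Finset.subset_insert j H))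
        (Finset.sum_le_sum_of_subset (Finset.subset_insert j H))
    rcases eq_or_ne (sumLIntegral μ (fun i => (μ (A i))⁻¹ • μ.restrict (A i)) A g N H Set.univ) ⊤
      with htop | htop
    · rw [htop, top_le_iff] at hle
      rw [hle]
      exact le_top
    · exact (ENNReal.add_le_add_iff_right htop).1 (hstep.trans (by gcongr))

/-- The decoupling inequality for nonnegative functions. -/
lemma exists_decoupling {q : ℝ} (hq : 0 < q) : ∃ C : ℝ≥0, ∀ {E ι : Type} [MeasurableSpace E]
    [Fintype ι] [DecidableEq ι] {μ : Measure E} {A : ι → Set E} {g : ι → E → ℝ≥0} (ℓ : ι → ℤ),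
    (∀ i, MeasurableSet (A i)) → (∀ i, 0 < μ (A i)) → (∀ i, μ (A i) < ⊤) →
    (∀ i, Measurable (g i)) → (∀ i, ∀ x ∉ A i, g i x = 0) →
    (∀ i j, i ≠ j → ℓ i ≤ ℓ j →
      ∀ x ∈ A j, ∀ x' ∈ A j, g i x = g i x' ∧ (x ∈ A i ↔ x' ∈ A i)) →
    let S := partialSum g Finset.univ
    let T := decoupledSum A g Finset.univ
    let π := Measure.pi fun i => (μ (A i))⁻¹ • μ.restrict (A i)
    ∫⁻ x, ((S x ^ q : ℝ≥0) : ℝ≥0∞) ∂μ ≤ C * ∫⁻ x, ∫⁻ y, ((T x y ^ q : ℝ≥0) : ℝ≥0∞) ∂π ∂μ ∧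
    ∫⁻ x, ∫⁻ y, ((T x y ^ q : ℝ≥0) : ℝ≥0∞) ∂π ∂μ ≤ C * ∫⁻ x, ((S x ^ q : ℝ≥0) : ℝ≥0∞) ∂μ := by
  obtain ⟨P, c, d, hP, hP0, hsymm, hle⟩ := exists_exchangeable_majorant hq
  refine ⟨d * (c + 1), ?_⟩
  intro E ι _ _ _ μ A g ℓ hA hA0 hA1 hg hgA hℓ S T π
  have hprob : ∀ i, IsProbabilityMeasure ((μ (A i))⁻¹ • μ.restrict (A i)) := fun i =>
    isProbabilityMeasure_inv_smul_restrict (hA0 i) (hA1 i)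
  have hconst : ∀ r : ℝ≥0∞, ∫⁻ _, r ∂π = r := fun r => by simp [π]
  have hSm : Measurable fun p : E × (ι → E) => S p.1 :=
    (measurable_partialSum hg _).comp measurable_fst
  have hTm : Measurable fun p : E × (ι → E) => T p.1 p.2 := measurable_decoupledSum hA hg _
  have key : ∀ X Y : E → (ι → E) → ℝ≥0, (Measurable fun p : E × (ι → E) => X p.1 p.2) →
      (Measurable fun p : E × (ι → E) => Y p.1 p.2) →
      ∫⁻ x, ∫⁻ y, (P (X x y) (Y x y) : ℝ≥0∞) ∂π ∂μ ≤
        ∫⁻ x, ∫⁻ y, ((c * Y x y ^ q : ℝ≥0) : ℝ≥0∞) ∂π ∂μ →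
      ∫⁻ x, ∫⁻ y, ((X x y ^ q : ℝ≥0) : ℝ≥0∞) ∂π ∂μ ≤
        (d * (c + 1) : ℝ≥0) * ∫⁻ x, ∫⁻ y, ((Y x y ^ q : ℝ≥0) : ℝ≥0∞) ∂π ∂μ := by
    intro X Y hX hY h
    have hYq : Measurable fun p : E × (ι → E) => ((Y p.1 p.2 ^ q : ℝ≥0) : ℝ≥0∞) :=
      (hY.pow_const q).coe_nnreal_ennreal
    have hYx : ∀ x, Measurable fun y => ((Y x y ^ q : ℝ≥0) : ℝ≥0∞) := fun x =>
      hYq.comp measurable_prodMk_left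
    have hYi := hYq.lintegral_prod_right' (ν := π)
    simp only [ENNReal.coe_mul, lintegral_const_mul _ (hYx _), lintegral_const_mul _ hYi] at h
    calc ∫⁻ x, ∫⁻ y, ((X x y ^ q : ℝ≥0) : ℝ≥0∞) ∂π ∂μ
        ≤ ∫⁻ x, ∫⁻ y, (d : ℝ≥0∞) * (P (X x y) (Y x y) + (Y x y ^ q : ℝ≥0)) ∂π ∂μ := by
          gcongr with x y
          exact_mod_cast hle (X x y) (Y x y)
      _ = d * (∫⁻ x, ∫⁻ y, (P (X x y) (Y x y) : ℝ≥0∞) ∂π ∂μ +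
            ∫⁻ x, ∫⁻ y, ((Y x y ^ q : ℝ≥0) : ℝ≥0∞) ∂π ∂μ) := by
          rw [← lintegral_add_right _ hYi, ← lintegral_const_mul']
          · refine lintegral_congr fun x => ?_
            rw [lintegral_const_mul' _ _ ENNReal.coe_ne_top, lintegral_add_right _ (hYx x)]
          · exact ENNReal.coe_ne_top
      _ ≤ d * (c * ∫⁻ x, ∫⁻ y, ((Y x y ^ q : ℝ≥0) : ℝ≥0∞) ∂π ∂μ +
            ∫⁻ x, ∫⁻ y, ((Y x y ^ q : ℝ≥0) : ℝ≥0∞) ∂π ∂μ) := by gcongr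
      _ = _ := by push_cast; ring
  constructor
  · have h := sumLIntegral_le_of_symm_le (P := P) (N := fun _ b => c * b ^ q) ℓ hA hA0 hA1 hg hgA
      hℓ hP (by unfold Function.uncurry; fun_prop) hP0 (fun _ _ b b' _ hb => by gcongr)
      hsymm Finset.univ
    simp only [sumLIntegral, Measure.restrict_univ] at h
    simpa only [hconst] using key (fun x _ => S x) T hSm hTm h
  · have h := sumLIntegral_le_of_symm_le (P := fun a b => P b a) (N := fun a _ => c * a ^ q) ℓ hA
      hA0 hA1 hg hgA hℓ (hP.comp measurable_swap) (by unfold Function.uncurry; fun_prop) hP0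
      (fun a a' _ _ ha _ => by gcongr)
      (fun a b s t => by
        have := hsymm b a t s
        rwa [add_comm (c * _)] at this ⊢) Finset.univ
    simp only [sumLIntegral, Measure.restrict_univ] at h
    simpa only [hconst] using key T (fun x _ => S x) hTm hSm h

end Decoupling

lemma exists_subset_of_le {E : Type} {A : ℤ → ℕ → Set E}
    (hnest : ∀ k j, ∃ i, A (k + 1) j ⊆ A k i) {k l : ℤ} (hkl : k ≤ l) (n : ℕ) :
    ∃ i, A l n ⊆ A k i := by
  induction l, hkl using Int.leInduction generalizing n with
  | base => exact ⟨n, subset_rfl⟩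
  | succ l _ ih =>
    obtain ⟨m, hm⟩ := hnest l n
    obtain ⟨i, hi⟩ := ih m
    exact ⟨i, hm.trans hi⟩

lemma sum_sq_sum_filter_level {G : Finset (ℤ × ℕ)} (u : {q // q ∈ G} → ℝ)
    (hu : ∀ q r, q ≠ r → q.1.1 = r.1.1 → u q * u r = 0) :
    ∑ k : {k // k ∈ G.image Prod.fst}, (∑ q ∈ G.attach.filter (fun q => q.1.1 = (k : ℤ)), u q) ^ 2 =
      ∑ q, u q ^ 2 := by
  have hsq : ∀ k : {k // k ∈ G.image Prod.fst},
      (∑ q ∈ G.attach.filter (fun q => q.1.1 = (k : ℤ)), u q) ^ 2 =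
        ∑ q ∈ G.attach.filter (fun q => q.1.1 = (k : ℤ)), u q ^ 2 := by
    intro k
    rw [sq, Finset.sum_mul_sum]
    refine Finset.sum_congr rfl fun q hq => ?_
    rw [Finset.sum_eq_single_of_mem q hq, sq]
    intro r hr hrq
    exact hu q r hrq.symm (((Finset.mem_filter.1 hq).2).trans ((Finset.mem_filter.1 hr).2).symm)
  simp only [hsq]
  rw [← Finset.sum_fiberwise Finset.univ
    (fun q : {q // q ∈ G} => (⟨q.1.1, Finset.mem_image_of_mem _ q.2⟩ : {k // k ∈ G.image Prod.fst}))]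
  refine Finset.sum_congr rfl fun k _ => ?_
  simp only [Subtype.ext_iff, Finset.univ_eq_attach]

/-- Khintchine's inequality for a family which is disjointly supported on each level. -/
lemma exists_khintchine_level {p : ℝ} (hp : 0 < p) :
    ∃ c C : ℝ≥0, 0 < c ∧ 0 < C ∧ ∀ (G : Finset (ℤ × ℕ)) (u : {q // q ∈ G} → ℝ),
      (∀ q r, q ≠ r → q.1.1 = r.1.1 → u q * u r = 0) →
      (c : ℝ≥0∞) * ((∑ q, ‖u q‖₊ ^ 2) ^ (p / 2) : ℝ≥0) ≤
        ENNReal.ofReal (signMean fun ε : {k // k ∈ G.image Prod.fst} → Bool =>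
          |∑ k, sgnB (ε k) * ∑ q ∈ G.attach.filter (fun q => q.1.1 = (k : ℤ)), u q| ^ p) ∧
      ENNReal.ofReal (signMean fun ε : {k // k ∈ G.image Prod.fst} → Bool =>
          |∑ k, sgnB (ε k) * ∑ q ∈ G.attach.filter (fun q => q.1.1 = (k : ℤ)), u q| ^ p) ≤
        (C : ℝ≥0∞) * ((∑ q, ‖u q‖₊ ^ 2) ^ (p / 2) : ℝ≥0) := by
  obtain ⟨c, C, hc, hC, h⟩ := exists_khintchine (half_pos hp)
  lift c to ℝ≥0 using hc.le
  lift C to ℝ≥0 using hC.le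
  refine ⟨c, C, by exact_mod_cast hc, by exact_mod_cast hC, fun G u hu => ?_⟩
  have hcoe : ∀ r : ℝ≥0, (r : ℝ≥0∞) * ((∑ q, ‖u q‖₊ ^ 2) ^ (p / 2) : ℝ≥0) =
      ENNReal.ofReal (r * (∑ q, u q ^ 2) ^ (p / 2)) := by
    intro r
    rw [← ENNReal.coe_mul, ← ENNReal.ofReal_coe_nnreal]
    simp
  have hk := h fun k : {k // k ∈ G.image Prod.fst} =>
    ∑ q ∈ G.attach.filter (fun q => q.1.1 = (k : ℤ)), u q
  rw [sum_sq_sum_filter_level u hu, mul_div_cancel₀ p two_ne_zero] at hk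
  rw [hcoe, hcoe]
  exact ⟨ENNReal.ofReal_le_ofReal hk.1, ENNReal.ofReal_le_ofReal hk.2⟩

open Classical in
/-- The tangent martingale trick (Lemma 4.6): decoupling for adapted families on a
filtered σ-finite measure space, with partitions `𝒜_k = {A k i : i ∈ ℕ}`.  Since only
finitely many of the `f_A` are nonzero (`A` with index in `G`), the product space may be
taken to be the finite product over `G`. -/
theorem statement9 (p : ℝ) (hp : 1 < p) :
    ∃ c C : ℝ, 0 < c ∧ 0 < C ∧
      ∀ (E : Type) [MeasurableSpace E] (μ : Measure E) [SigmaFinite μ],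
      ∀ A : ℤ → ℕ → Set E,
        (∀ k i, MeasurableSet (A k i)) →
        (∀ k, Pairwise fun i j => Disjoint (A k i) (A k j)) →
        (∀ k, (⋃ i, A k i) = Set.univ) →
        (∀ k i, 0 < μ (A k i)) →
        (∀ k i, μ (A k i) < ⊤) →
        (∀ k j, ∃ i, A (k+1) j ⊆ A k i) →
      ∀ (f : ℤ → ℕ → E → ℝ) (G : Finset (ℤ × ℕ)),
        (∀ k i, Measurable (f k i)) →
        (∀ k i, (k, i) ∉ G → f k i = 0) →
        (∀ k i, ∀ x ∉ A k i, f k i x = 0) →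
        (∀ k i j, ∃ v : ℝ, ∀ x ∈ A (k+1) j, f k i x = v) →
        (ENNReal.ofReal c *
            (∫⁻ x, ∫⁻ y : {q // q ∈ G} → E,
              ENNReal.ofReal
                (((2:ℝ) ^ (G.image Prod.fst).card)⁻¹ *
                  ∑ ε : {k // k ∈ G.image Prod.fst} → Bool,
                    |∑ k ∈ (G.image Prod.fst).attach,
                      sgnB (ε k) *
                        ∑ q ∈ G.attach.filter (fun q => q.1.1 = (k:ℤ)),
                          f q.1.1 q.1.2 (y q) * (A q.1.1 q.1.2).indicator 1 x| ^ p)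
              ∂(Measure.pi fun q : {q // q ∈ G} =>
                  (μ (A q.1.1 q.1.2))⁻¹ • μ.restrict (A q.1.1 q.1.2)) ∂μ) ≤
          ∫⁻ x,
            ENNReal.ofReal
              (((2:ℝ) ^ (G.image Prod.fst).card)⁻¹ *
                ∑ ε : {k // k ∈ G.image Prod.fst} → Bool,
                  |∑ k ∈ (G.image Prod.fst).attach,
                    sgnB (ε k) *
                      ∑ q ∈ G.filter (fun q => q.1 = (k:ℤ)), f q.1 q.2 x| ^ p) ∂μ) ∧
        ((∫⁻ x,
            ENNReal.ofReal
              (((2:ℝ) ^ (G.image Prod.fst).card)⁻¹ *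
                ∑ ε : {k // k ∈ G.image Prod.fst} → Bool,
                  |∑ k ∈ (G.image Prod.fst).attach,
                    sgnB (ε k) *
                      ∑ q ∈ G.filter (fun q => q.1 = (k:ℤ)), f q.1 q.2 x| ^ p) ∂μ) ≤
          ENNReal.ofReal C *
            ∫⁻ x, ∫⁻ y : {q // q ∈ G} → E,
              ENNReal.ofReal
                (((2:ℝ) ^ (G.image Prod.fst).card)⁻¹ *
                  ∑ ε : {k // k ∈ G.image Prod.fst} → Bool,
                    |∑ k ∈ (G.image Prod.fst).attach,
                      sgnB (ε k) *
                        ∑ q ∈ G.attach.filter (fun q => q.1.1 = (k:ℤ)),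
                          f q.1.1 q.1.2 (y q) * (A q.1.1 q.1.2).indicator 1 x| ^ p)
              ∂(Measure.pi fun q : {q // q ∈ G} =>
                  (μ (A q.1.1 q.1.2))⁻¹ • μ.restrict (A q.1.1 q.1.2)) ∂μ) := by
  have hp0 : 0 < p := by linarith
  obtain ⟨c₁, C₁, hc₁, hC₁, hkh⟩ := exists_khintchine_level hp0
  obtain ⟨K, hdec⟩ := exists_decoupling (half_pos hp0)
  refine ⟨(c₁ / (C₁ * (K + 1)) : ℝ≥0), (C₁ * (K + 1) / c₁ : ℝ≥0), by positivity, by positivity, ?_⟩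
  intro E _ μ _ A hA hdisj _ hA0 hA1 hnest f G hf _ hsupp hconst
  have hlevel : ∀ q r : {q // q ∈ G}, q ≠ r → q.1.1 = r.1.1 → ∀ x ∈ A r.1.1 r.1.2,
      x ∉ A q.1.1 q.1.2 := by
    intro q r hqr he x hx hx'
    have hne : q.1.2 ≠ r.1.2 := fun h => hqr (Subtype.ext (Prod.ext he h))
    rw [← he] at hx
    exact Set.disjoint_left.1 (hdisj q.1.1 hne) hx' hx
  obtain ⟨h1, h2⟩ := hdec (μ := μ) (A := fun q : {q // q ∈ G} => A q.1.1 q.1.2)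
    (g := fun q x => ‖f q.1.1 q.1.2 x‖₊ ^ 2) (fun q => q.1.1) (fun q => hA _ _)
    (fun q => hA0 _ _) (fun q => hA1 _ _) (fun q => (hf _ _).nnnorm.pow_const 2)
    (fun q x hx => by simp [hsupp _ _ x hx])
    (by
      intro q r hqr hle x hx x' hx'
      rcases hle.eq_or_lt with he | hlt
      · have h := hlevel q r hqr he x hx
        have h' := hlevel q r hqr he x' hx'
        simp [hsupp _ _ x h, hsupp _ _ x' h', h, h']
      · obtain ⟨m, hm⟩ := exists_subset_of_le hnest (Int.add_one_le_of_lt hlt) r.1.2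
        obtain ⟨v, hv⟩ := hconst q.1.1 q.1.2 m
        obtain ⟨i, hi⟩ := hnest q.1.1 m
        refine ⟨by simp only [hv x (hm hx), hv x' (hm hx')], ?_⟩
        have hiff : ∀ z ∈ A r.1.1 r.1.2, (z ∈ A q.1.1 q.1.2 ↔ q.1.2 = i) := fun z hz =>
          ⟨fun h => by_contra fun hne => Set.disjoint_left.1 (hdisj q.1.1 hne) h (hi (hm hz)),
            fun h => h ▸ hi (hm hz)⟩
        rw [hiff x hx, hiff x' hx'])
  simp only [partialSum, decoupledSum] at h1 h2
  set IS := ∫⁻ x, (((∑ q : {q // q ∈ G}, ‖f q.1.1 q.1.2 x‖₊ ^ 2) ^ (p / 2) : ℝ≥0) : ℝ≥0∞) ∂μ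
  set IT := ∫⁻ x, ∫⁻ y : {q // q ∈ G} → E, (((∑ q : {q // q ∈ G}, (A q.1.1 q.1.2).indicator
    (fun _ => ‖f q.1.1 q.1.2 (y q)‖₊ ^ 2) x) ^ (p / 2) : ℝ≥0) : ℝ≥0∞)
    ∂(Measure.pi fun q : {q // q ∈ G} => (μ (A q.1.1 q.1.2))⁻¹ • μ.restrict (A q.1.1 q.1.2)) ∂μ
  have hL := fun x => hkh G (fun q => f q.1.1 q.1.2 x) (fun q r hqr he => by
    by_cases hx : x ∈ A r.1.1 r.1.2
    · rw [hsupp _ _ x (hlevel q r hqr he x hx), zero_mul]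
    · rw [hsupp _ _ x hx, mul_zero])
  have hR := fun x (y : {q // q ∈ G} → E) =>
    hkh G (fun q => f q.1.1 q.1.2 (y q) * (A q.1.1 q.1.2).indicator 1 x) (fun q r hqr he => by
      by_cases hx : x ∈ A r.1.1 r.1.2
      · simp [hlevel q r hqr he x hx]
      · simp [hx])
  have hind : ∀ (x : E) (y : {q // q ∈ G} → E) (q : {q // q ∈ G}),
      ‖f q.1.1 q.1.2 (y q) * (A q.1.1 q.1.2).indicator 1 x‖₊ ^ 2 =
        (A q.1.1 q.1.2).indicator (fun _ => ‖f q.1.1 q.1.2 (y q)‖₊ ^ 2) x := fun x y q => by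
    by_cases hx : x ∈ A q.1.1 q.1.2 <;> simp [hx]
  have hfilter : ∀ (x : E) (k : ℤ), ∑ q ∈ G.attach.filter (fun q => q.1.1 = k), f q.1.1 q.1.2 x =
      ∑ q ∈ G.filter (fun q => q.1 = k), f q.1 q.2 x := fun x k => by
    rw [Finset.sum_filter, Finset.sum_filter]
    exact Finset.sum_attach G fun q => if q.1 = k then f q.1 q.2 x else 0
  simp only [hind] at hR
  simp only [hfilter] at hL
  simp only [signMean, Fintype.card_coe, Finset.univ_eq_attach] at hL hR
  set L := ∫⁻ x, ENNReal.ofReal (((2:ℝ) ^ (G.image Prod.fst).card)⁻¹ *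
    ∑ ε : {k // k ∈ G.image Prod.fst} → Bool, |∑ k ∈ (G.image Prod.fst).attach,
      sgnB (ε k) * ∑ q ∈ G.filter (fun q => q.1 = (k:ℤ)), f q.1 q.2 x| ^ p) ∂μ
  set R := ∫⁻ x, ∫⁻ y : {q // q ∈ G} → E, ENNReal.ofReal (((2:ℝ) ^ (G.image Prod.fst).card)⁻¹ *
    ∑ ε : {k // k ∈ G.image Prod.fst} → Bool, |∑ k ∈ (G.image Prod.fst).attach,
      sgnB (ε k) * ∑ q ∈ G.attach.filter (fun q => q.1.1 = (k:ℤ)),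
        f q.1.1 q.1.2 (y q) * (A q.1.1 q.1.2).indicator 1 x| ^ p)
    ∂(Measure.pi fun q : {q // q ∈ G} => (μ (A q.1.1 q.1.2))⁻¹ • μ.restrict (A q.1.1 q.1.2)) ∂μ
  have hSL : c₁ * IS ≤ L := by
    rw [← lintegral_const_mul' _ _ ENNReal.coe_ne_top]
    exact lintegral_mono fun x => (hL x).1
  have hLS : L ≤ C₁ * IS := by
    rw [← lintegral_const_mul' _ _ ENNReal.coe_ne_top]
    exact lintegral_mono fun x => (hL x).2
  have hTR : c₁ * IT ≤ R := by
    rw [← lintegral_const_mul' _ _ ENNReal.coe_ne_top]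
    refine lintegral_mono fun x => ?_
    rw [← lintegral_const_mul' _ _ ENNReal.coe_ne_top]
    exact lintegral_mono fun y => (hR x y).1
  have hRT : R ≤ C₁ * IT := by
    rw [← lintegral_const_mul' _ _ ENNReal.coe_ne_top]
    refine lintegral_mono fun x => ?_
    rw [← lintegral_const_mul' _ _ ENNReal.coe_ne_top]
    exact lintegral_mono fun y => (hR x y).2
  rw [ENNReal.ofReal_coe_nnreal, ENNReal.ofReal_coe_nnreal]
  have hK : (K : ℝ≥0∞) ≤ (K + 1 : ℝ≥0) := ENNReal.coe_le_coe.2 le_self_add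
  constructor
  · calc ((c₁ / (C₁ * (K + 1)) : ℝ≥0) : ℝ≥0∞) * R
        ≤ (c₁ / (C₁ * (K + 1)) : ℝ≥0) * (C₁ * ((K + 1 : ℝ≥0) * IS)) := by
          gcongr
          exact hRT.trans (by gcongr; exact h2.trans (by gcongr))
      _ = ((c₁ / (C₁ * (K + 1)) * (C₁ * (K + 1)) : ℝ≥0) : ℝ≥0∞) * IS := by
          push_cast; ring
      _ = c₁ * IS := by rw [div_mul_cancel₀ _ (by positivity)]
      _ ≤ L := hSL
  · calc L ≤ C₁ * ((K + 1 : ℝ≥0) * IT) := hLS.trans (by gcongr; exact h1.trans (by gcongr))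
      _ = ((C₁ * (K + 1) / c₁ * c₁ : ℝ≥0) : ℝ≥0∞) * IT := by
          rw [div_mul_cancel₀ _ hc₁.ne']; push_cast; ring
      _ = (C₁ * (K + 1) / c₁ : ℝ≥0) * (c₁ * IT) := by push_cast; ring
      _ ≤ _ := by gcongr

end
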